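/- Let n ∈ ℕ, 1 ≤ p < ∞, p < r < ∞, 0 < κ < 1, and let q satisfy r < q < ∞. If f is a measurable function on ℝ^n with ‖f‖_{LM^{p,r;κ}} < ∞ and ‖f‖_{L^∞} < ∞, then f ∈ M^{q;κ}(ℝ^n) and ‖f‖_{M^{q;κ}} ≤ 2 · (‖f‖_{LM^{p,r;κ}})^{p/q} · (‖f‖_{L^∞})^{1−p/q}. -/

import Mathlib

open MeasureTheory ENNReal

noncomputable section

variable {n : ℕ}

/-- ℝ^n as Euclidean space with Lebesgue measure. -/
abbrev En (n : ℕ) : Type := EuclideanSpace ℝ (Fin n)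

/-- Distribution function d_f(λ) = m({x : |f x| > λ}). -/
def distFn (f : En n → ℝ) (l : ℝ) : ℝ≥0∞ := volume {x | l < |f x|}

/-- Non-increasing rearrangement f*(t) = inf {λ > 0 : d_f(λ) ≤ t}. -/
def rearr (f : En n → ℝ) (t : ℝ) : ℝ≥0∞ :=
  sInf (ENNReal.ofReal '' {l : ℝ | 0 < l ∧ distFn f l ≤ ENNReal.ofReal t})

/-- Lorentz quasi-norm ‖f‖_{L^{p,r}}; the second index r lives in ℝ≥0∞. -/
def lorentzNorm (f : En n → ℝ) (p : ℝ) (r : ℝ≥0∞) : ℝ≥0∞ :=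
  if r = ∞ then ⨆ (s : ℝ) (_ : 0 < s), ENNReal.ofReal (s ^ (1 / p)) * rearr f s
  else (∫⁻ s in Set.Ioi (0 : ℝ),
      (ENNReal.ofReal (s ^ (1 / p)) * rearr f s) ^ r.toReal / ENNReal.ofReal s) ^ (1 / r.toReal)

/-- The L^q norm, 1 ≤ q < ∞. -/
def lqNorm (f : En n → ℝ) (q : ℝ) : ℝ≥0∞ :=
  (∫⁻ x, ENNReal.ofReal |f x| ^ q) ^ (1 / q)

/-- The L^∞ norm (essential supremum of |f|). -/
def linftyNorm (f : En n → ℝ) : ℝ≥0∞ :=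
  essSup (fun x => ENNReal.ofReal |f x|) volume

/-- Average of f over the ball B(c, ρ). -/
def ballAvg (f : En n → ℝ) (c : En n) (ρ : ℝ) : ℝ := ⨍ y in Metric.ball c ρ, f y

/-- The BMO seminorm: sup over balls of (1/m(B)) ∫_B |f - f_B|. -/
def bmoNorm (f : En n → ℝ) : ℝ≥0∞ :=
  ⨆ (c : En n) (ρ : ℝ) (_ : 0 < ρ),
    (volume (Metric.ball c ρ))⁻¹ *
      ∫⁻ x in Metric.ball c ρ, ENNReal.ofReal |f x - ballAvg f c ρ|

/-- The Morrey norm ‖f‖_{M^{p;κ}} = sup_B m(B)^{-κ/p} (∫_B |f|^p)^{1/p}. -/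
def morreyNorm (f : En n → ℝ) (p κ : ℝ) : ℝ≥0∞ :=
  ⨆ (c : En n) (ρ : ℝ) (_ : 0 < ρ),
    volume (Metric.ball c ρ) ^ (-(κ / p)) *
      (∫⁻ x in Metric.ball c ρ, ENNReal.ofReal |f x| ^ p) ^ (1 / p)

/-- The weak Morrey norm ‖f‖_{WM^{p;κ}}. -/
def wMorreyNorm (f : En n → ℝ) (p κ : ℝ) : ℝ≥0∞ :=
  ⨆ (c : En n) (ρ : ℝ) (_ : 0 < ρ),
    volume (Metric.ball c ρ) ^ (-(κ / p)) *
      ⨆ (l : ℝ) (_ : 0 < l),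
        ENNReal.ofReal l * volume {x ∈ Metric.ball c ρ | l < |f x|} ^ (1 / p)

/-- The Lorentz–Morrey quasi-norm ‖f‖_{LM^{p,r;κ}} = sup_B m(B)^{-κ/p} ‖f·1_B‖_{L^{p,r}}. -/
def lmNorm (f : En n → ℝ) (p : ℝ) (r : ℝ≥0∞) (κ : ℝ) : ℝ≥0∞ :=
  ⨆ (c : En n) (ρ : ℝ) (_ : 0 < ρ),
    volume (Metric.ball c ρ) ^ (-(κ / p)) *
      lorentzNorm ((Metric.ball c ρ).indicator f) p r

/-- The averaged rearrangement f**(t) = (1/t) ∫₀^t f*(τ) dτ. -/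
def doubleStar (f : En n → ℝ) (t : ℝ) : ℝ≥0∞ :=
  (ENNReal.ofReal t)⁻¹ * ∫⁻ τ in Set.Ioc (0 : ℝ) t, rearr f τ

/-- ‖f‖_𝒲 = sup_{t>0} (f**(t) - f*(t)). -/
def wNorm (f : En n → ℝ) : ℝ≥0∞ :=
  ⨆ (t : ℝ) (_ : 0 < t), (doubleStar f t - rearr f t)

/-- Φ_p(t) = exp t − Σ_{j<p} t^j/j!. -/
def Phi (p : ℕ) (t : ℝ) : ℝ :=
  Real.exp t - ∑ j ∈ Finset.range p, t ^ j / (Nat.factorial j : ℝ)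

lemma rearr_antitone (g : En n → ℝ) : Antitone (rearr g) := fun _ _ hst =>
  sInf_le_sInf <| Set.image_mono fun _ hl =>
    ⟨hl.1, hl.2.trans (ENNReal.ofReal_le_ofReal hst)⟩

lemma rearr_le_of_ae_le {g : En n → ℝ} {M : ℝ} (hM : 0 ≤ M) (hg : ∀ᵐ x, |g x| ≤ M) (t : ℝ) :
    rearr g t ≤ ENNReal.ofReal M := by
  refine ENNReal.le_of_forall_pos_le_add fun ε hε _ => ?_
  have hε' : (0 : ℝ) < ε := hε
  have h : rearr g t ≤ ENNReal.ofReal (M + ε) := by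
    refine sInf_le ⟨M + ε, ⟨by positivity, ?_⟩, rfl⟩
    have : distFn g (M + ε) = 0 := by
      refine measure_mono_null (fun x (hx : M + ε < |g x|) => ?_) (ae_iff.1 hg)
      simp only [Set.mem_ofPred_eq, not_le]
      linarith
    simp [this]
  rwa [ENNReal.ofReal_add hM hε'.le, ENNReal.ofReal_coe_nnreal] at h

/-- Right continuity of the distribution function, in the form of an upper bound. -/
lemma distFn_le_of_forall_gt {g : En n → ℝ} {l : ℝ} {c : ℝ≥0∞}
    (h : ∀ l', l < l' → distFn g l' ≤ c) : distFn g l ≤ c := by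
  obtain ⟨u, hu_anti, hu_gt, hu_lim⟩ := exists_seq_strictAnti_tendsto l
  have hset : {x | l < |g x|} = ⋃ k, {x | u k < |g x|} := by
    ext x
    simp only [Set.mem_ofPred_eq, Set.mem_iUnion]
    exact ⟨fun hx => (hu_lim.eventually_lt_const hx).exists,
      fun ⟨k, hk⟩ => (hu_gt k).trans hk⟩
  have hmono : Monotone fun k => {x | u k < |g x|} := fun i j hij x hx =>
    (hu_anti.antitone hij).trans_lt hx
  rw [distFn, hset, hmono.measure_iUnion]
  exact iSup_le fun k => h _ (hu_gt k)

lemma lt_rearr_of_lt_distFn {g : En n → ℝ} {l t : ℝ} (hl : 0 < l)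
    (h : ENNReal.ofReal t < distFn g l) : ENNReal.ofReal l < rearr g t := by
  by_contra! hle
  refine h.not_ge (distFn_le_of_forall_gt fun l' hl' => ?_)
  obtain ⟨_, ⟨k, ⟨_, hk⟩, rfl⟩, hkl⟩ := sInf_lt_iff.1
    (hle.trans_lt ((ENNReal.ofReal_lt_ofReal_iff (hl.trans hl')).2 hl'))
  have hkl' : k < l' := (ENNReal.ofReal_lt_ofReal_iff (hl.trans hl')).1 hkl
  exact (measure_mono fun x (hx : l' < |g x|) => hkl'.trans hx).trans hk

lemma distFn_le_volume_lt_rearr (g : En n → ℝ) {l : ℝ} (hl : 0 < l) :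
    distFn g l ≤ volume.restrict (Set.Ioi 0) {s | ENNReal.ofReal l < rearr g s} := by
  refine ENNReal.le_of_forall_nnreal_lt fun c hc => ?_
  have hsub : Set.Ioc (0 : ℝ) c ⊆ {s | ENNReal.ofReal l < rearr g s} ∩ Set.Ioi 0 := by
    refine fun s hs => ⟨lt_rearr_of_lt_distFn hl (lt_of_le_of_lt ?_ hc), hs.1⟩
    rw [← ENNReal.ofReal_coe_nnreal]
    exact ENNReal.ofReal_le_ofReal hs.2
  rw [Measure.restrict_apply' measurableSet_Ioi]
  simpa using measure_mono (μ := volume) hsub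

lemma lintegral_rpow_le_lintegral_rearr {g : En n → ℝ} (hg : Measurable g) {q : ℝ} (hq : 0 < q)
    (hfin : ∀ t, rearr g t ≠ ∞) :
    ∫⁻ x, ENNReal.ofReal (|g x| ^ q) ≤
      ∫⁻ s in Set.Ioi (0 : ℝ), ENNReal.ofReal ((rearr g s).toReal ^ q) := by
  rw [lintegral_rpow_eq_lintegral_meas_lt_mul volume (.of_forall fun x => abs_nonneg (g x))
      (by fun_prop) hq,
    lintegral_rpow_eq_lintegral_meas_lt_mul _ (.of_forall fun s => toReal_nonneg)
      (rearr_antitone g).measurable.ennreal_toReal.aemeasurable hq]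
  gcongr ENNReal.ofReal q * ?_
  refine setLIntegral_mono' measurableSet_Ioi fun l hl => ?_
  gcongr
  refine (distFn_le_volume_lt_rearr g hl).trans (measure_mono fun s hs => ?_)
  exact (ENNReal.ofReal_lt_iff_lt_toReal (le_of_lt hl) (hfin s)).1 hs

lemma rpow_le_weighted_rpow {p r q x m s T : ℝ} (hp : 0 < p) (hpr : p < r) (hrq : r < q)
    (hx : 0 ≤ x) (hxm : x ≤ m) (hT : 0 < T) (hTs : T ≤ s) :
    x ^ q ≤ m ^ (q - r) * T ^ (1 - r / p) * ((s ^ (1 / p) * x) ^ r / s) := by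
  have hs : 0 < s := hT.trans_le hTs
  have hweight : 1 ≤ T ^ (1 - r / p) * (s ^ (r / p) / s) := by
    have : s ^ (r / p) / s = s ^ (r / p - 1) := by rw [Real.rpow_sub_one hs.ne']
    rw [this, show 1 - r / p = -(r / p - 1) by ring, Real.rpow_neg hT.le, ← div_eq_inv_mul,
      one_le_div (by positivity)]
    have : 1 ≤ r / p := (one_le_div hp).2 hpr.le
    exact Real.rpow_le_rpow hT.le hTs (by linarith)
  have hsplit : x ^ q ≤ m ^ (q - r) * x ^ r := by
    calc x ^ q = x ^ (q - r) * x ^ r := by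
          rw [← Real.rpow_add_of_nonneg hx (by linarith) (by linarith)]; congr 1; ring
      _ ≤ _ := by
          gcongr
  have hm : 0 ≤ m := hx.trans hxm
  calc x ^ q ≤ m ^ (q - r) * x ^ r * 1 := by rw [mul_one]; exact hsplit
    _ ≤ m ^ (q - r) * x ^ r * (T ^ (1 - r / p) * (s ^ (r / p) / s)) := by gcongr
    _ = _ := by
        rw [Real.mul_rpow (by positivity) hx, ← Real.rpow_mul hs.le, one_div_mul_eq_div]
        ring

/-- Splitting the integral at `T = (a / m) ^ p`. -/
lemma lintegral_rpow_le_of_weighted {p r q a m : ℝ} (hp : 0 < p) (hpr : p < r) (hrq : r < q)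
    (ha : 0 < a) (hm : 0 < m) {h : ℝ → ℝ} (h0 : ∀ s, 0 ≤ h s) (hh : ∀ s, h s ≤ m)
    (hF : ∫⁻ s in Set.Ioi (0 : ℝ), ENNReal.ofReal ((s ^ (1 / p) * h s) ^ r / s) ≤
      ENNReal.ofReal (a ^ r)) :
    ∫⁻ s in Set.Ioi (0 : ℝ), ENNReal.ofReal (h s ^ q) ≤
      ENNReal.ofReal (2 * a ^ p * m ^ (q - p)) := by
  set T : ℝ := (a / m) ^ p with hTdef
  have hT : 0 < T := by positivity
  set c : ℝ := m ^ (q - r) * T ^ (1 - r / p) with hcdef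
  have hc : 0 ≤ c := by positivity
  have hhead : ∫⁻ s in Set.Ioc 0 T, ENNReal.ofReal (h s ^ q) ≤ ENNReal.ofReal (m ^ q * T) := by
    calc ∫⁻ s in Set.Ioc 0 T, ENNReal.ofReal (h s ^ q)
        ≤ ∫⁻ s in Set.Ioc 0 T, ENNReal.ofReal (m ^ q) := by
          refine lintegral_mono fun s => ENNReal.ofReal_le_ofReal ?_
          exact Real.rpow_le_rpow (h0 s) (hh s) (by linarith)
      _ = _ := by
          rw [setLIntegral_const, Real.volume_Ioc, sub_zero, ENNReal.ofReal_mul (by positivity)]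
  have htail : ∫⁻ s in Set.Ioi T, ENNReal.ofReal (h s ^ q) ≤ ENNReal.ofReal (c * a ^ r) := by
    calc ∫⁻ s in Set.Ioi T, ENNReal.ofReal (h s ^ q)
        ≤ ∫⁻ s in Set.Ioi T,
            ENNReal.ofReal c * ENNReal.ofReal ((s ^ (1 / p) * h s) ^ r / s) := by
          refine setLIntegral_mono' measurableSet_Ioi fun s hs => ?_
          rw [← ENNReal.ofReal_mul hc]
          exact ENNReal.ofReal_le_ofReal
            (rpow_le_weighted_rpow hp hpr hrq (h0 s) (hh s) hT (le_of_lt hs))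
      _ = ENNReal.ofReal c *
            ∫⁻ s in Set.Ioi T, ENNReal.ofReal ((s ^ (1 / p) * h s) ^ r / s) :=
          lintegral_const_mul' _ _ ofReal_ne_top
      _ ≤ ENNReal.ofReal c * ENNReal.ofReal (a ^ r) := by
          gcongr
          exact (lintegral_mono_set (Set.Ioi_subset_Ioi hT.le)).trans hF
      _ = _ := by rw [ENNReal.ofReal_mul hc]
  have hTm : m ^ q * T = a ^ p * m ^ (q - p) := by
    rw [hTdef, Real.div_rpow ha.le hm.le, Real.rpow_sub hm]
    ring
  have hca : c * a ^ r = a ^ p * m ^ (q - p) := by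
    have hTpow : T ^ (1 - r / p) = a ^ (p - r) * m ^ (r - p) := by
      rw [hTdef, ← Real.rpow_mul (by positivity), show p * (1 - r / p) = p - r by field_simp,
        Real.div_rpow ha.le hm.le, show r - p = -(p - r) by ring, Real.rpow_neg hm.le,
        div_eq_mul_inv]
    rw [hcdef, hTpow, show m ^ (q - r) * (a ^ (p - r) * m ^ (r - p)) * a ^ r =
      (a ^ (p - r) * a ^ r) * (m ^ (q - r) * m ^ (r - p)) by ring, ← Real.rpow_add ha,
      ← Real.rpow_add hm]
    congr 2 <;> ring
  calc ∫⁻ s in Set.Ioi (0 : ℝ), ENNReal.ofReal (h s ^ q)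
      = ∫⁻ s in Set.Ioc 0 T ∪ Set.Ioi T, ENNReal.ofReal (h s ^ q) := by
        rw [Set.Ioc_union_Ioi_eq_Ioi hT.le]
    _ ≤ _ := lintegral_union_le _ _ _
    _ ≤ ENNReal.ofReal (m ^ q * T) + ENNReal.ofReal (c * a ^ r) := add_le_add hhead htail
    _ = _ := by
        rw [hTm, hca, ← ENNReal.ofReal_add (by positivity) (by positivity)]
        congr 1
        ring

/-- Interpolation between `L^{p,r}` and `L^∞`. -/
lemma lintegral_rpow_le_lorentzNorm {g : En n → ℝ} (hg : Measurable g) {p r q m : ℝ}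
    (hp : 0 < p) (hpr : p < r) (hrq : r < q) (hm : 0 ≤ m) (hgm : ∀ᵐ x, |g x| ≤ m)
    (hfin : lorentzNorm g p (ENNReal.ofReal r) ≠ ∞) :
    ∫⁻ x, ENNReal.ofReal (|g x| ^ q) ≤
      2 * lorentzNorm g p (ENNReal.ofReal r) ^ p * ENNReal.ofReal m ^ (q - p) := by
  have hr : 0 < r := hp.trans hpr
  set A := lorentzNorm g p (ENNReal.ofReal r) with hA
  have hle : ∀ t, rearr g t ≤ ENNReal.ofReal m := rearr_le_of_ae_le hm hgm
  have hne : ∀ t, rearr g t ≠ ∞ := fun t => ne_top_of_le_ne_top ofReal_ne_top (hle t)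
  have hAr : ∫⁻ s in Set.Ioi (0 : ℝ),
      ENNReal.ofReal ((s ^ (1 / p) * (rearr g s).toReal) ^ r / s) = A ^ r := by
    rw [hA, lorentzNorm, if_neg ofReal_ne_top, ENNReal.toReal_ofReal hr.le, one_div r,
      ENNReal.rpow_inv_rpow hr.ne']
    refine setLIntegral_congr_fun measurableSet_Ioi fun s (hs : 0 < s) => ?_
    rw [ENNReal.ofReal_div_of_pos hs, ← ENNReal.ofReal_rpow_of_nonneg (by positivity) hr.le,
      ENNReal.ofReal_mul (by positivity), ENNReal.ofReal_toReal (hne s)]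
  have hbound : ∀ ε : ℝ, 0 < ε → ∫⁻ x, ENNReal.ofReal (|g x| ^ q) ≤
      ENNReal.ofReal (2 * (A.toReal + ε) ^ p * (m + ε) ^ (q - p)) := by
    intro ε hε
    have hA0 : 0 ≤ A.toReal := toReal_nonneg
    refine (lintegral_rpow_le_lintegral_rearr hg (hr.trans hrq) hne).trans
      (lintegral_rpow_le_of_weighted hp hpr hrq (by positivity) (by positivity)
        (fun s => toReal_nonneg) (fun s => ?_) ?_)
    · exact (ENNReal.toReal_le_of_le_ofReal hm (hle s)).trans (by linarith)
    · rw [hAr, ← ENNReal.ofReal_rpow_of_nonneg (by positivity) hr.le]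
      refine ENNReal.rpow_le_rpow ?_ hr.le
      exact (ENNReal.le_ofReal_iff_toReal_le hfin (by positivity)).2 (by linarith)
  have hcont : Continuous fun ε : ℝ =>
      ENNReal.ofReal (2 * (A.toReal + ε) ^ p * (m + ε) ^ (q - p)) := by
    refine ENNReal.continuous_ofReal.comp ?_
    refine (continuous_const.mul ?_).mul ?_
    · exact (Real.continuous_rpow_const hp.le).comp (by fun_prop)
    · exact (Real.continuous_rpow_const (by linarith)).comp (by fun_prop)
  have hlim := (hcont.tendsto 0).mono_left (nhdsWithin_le_nhds (s := Set.Ioi 0))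
  refine (ge_of_tendsto hlim (eventually_mem_nhdsWithin.mono hbound)).trans_eq ?_
  rw [add_zero, add_zero, ENNReal.ofReal_mul (by positivity), ENNReal.ofReal_mul (by positivity),
    ← ENNReal.ofReal_rpow_of_nonneg toReal_nonneg hp.le,
    ← ENNReal.ofReal_rpow_of_nonneg hm (by linarith), ENNReal.ofReal_toReal hfin]
  norm_num

theorem stmt4 (n : ℕ) (p r q κ : ℝ) (hp : 1 ≤ p) (hpr : p < r) (hrq : r < q)
    (hκ0 : 0 < κ) (hκ1 : κ < 1)
    (f : En n → ℝ) (hf : Measurable f)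
    (hLM : lmNorm f p (ENNReal.ofReal r) κ ≠ ∞)
    (hLinf : linftyNorm f ≠ ∞) :
    morreyNorm f q κ ≠ ∞ ∧
      morreyNorm f q κ ≤
        2 * lmNorm f p (ENNReal.ofReal r) κ ^ (p / q) * linftyNorm f ^ (1 - p / q) := by
  have hp0 : 0 < p := by linarith
  have hq0 : 0 < q := by linarith
  have hpq0 : 0 ≤ p / q := by positivity
  have hpq1 : 0 ≤ 1 - p / q := sub_nonneg.2 ((div_le_one hq0).2 (by linarith))
  have main : morreyNorm f q κ ≤
      2 * lmNorm f p (ENNReal.ofReal r) κ ^ (p / q) * linftyNorm f ^ (1 - p / q) := by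
    refine iSup_le fun c => iSup_le fun ρ => iSup_le fun hρ => ?_
    set B := Metric.ball c ρ
    set V := volume B
    set A := lorentzNorm (B.indicator f) p (ENNReal.ofReal r)
    have hV0 : V ≠ 0 := (Metric.measure_ball_pos volume c hρ).ne'
    have hVtop : V ≠ ∞ := measure_ball_lt_top.ne
    have hVA : V ^ (-(κ / p)) * A ≤ lmNorm f p (ENNReal.ofReal r) κ :=
      le_iSup_of_le c (le_iSup_of_le ρ (le_iSup_of_le hρ le_rfl))
    have hVne : V ^ (-(κ / p)) ≠ 0 := by simp [ENNReal.rpow_eq_zero_iff, hV0, hVtop]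
    have hAfin : A ≠ ∞ := fun h => by
      rw [h, ENNReal.mul_top hVne] at hVA
      exact hLM (top_le_iff.1 hVA)
    have hae : ∀ᵐ x, |B.indicator f x| ≤ (linftyNorm f).toReal := by
      filter_upwards [ENNReal.ae_le_essSup (μ := volume) fun x => ENNReal.ofReal |f x|] with x hx
      have hfx := (ENNReal.ofReal_le_iff_le_toReal hLinf).1 hx
      by_cases hxB : x ∈ B
      · simpa [hxB] using hfx
      · simp [hxB]
    have hint : ∫⁻ x in B, ENNReal.ofReal |f x| ^ q ≤
        2 * A ^ p * linftyNorm f ^ (q - p) := by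
      have := lintegral_rpow_le_lorentzNorm (hf.indicator measurableSet_ball) hp0 hpr hrq
        toReal_nonneg hae hAfin
      rw [ENNReal.ofReal_toReal hLinf] at this
      refine le_of_eq_of_le ?_ this
      rw [← lintegral_indicator measurableSet_ball]
      refine lintegral_congr fun x => ?_
      by_cases hxB : x ∈ B
      · simp [B, hxB, ENNReal.ofReal_rpow_of_nonneg (abs_nonneg _) hq0.le]
      · simp [B, hxB, Real.zero_rpow hq0.ne']
    calc V ^ (-(κ / q)) * (∫⁻ x in B, ENNReal.ofReal |f x| ^ q) ^ (1 / q)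
        ≤ V ^ (-(κ / q)) * (2 * A ^ p * linftyNorm f ^ (q - p)) ^ (1 / q) := by gcongr
      _ = 2 ^ (1 / q) * (V ^ (-(κ / p)) * A) ^ (p / q) * linftyNorm f ^ (1 - p / q) := by
          rw [ENNReal.mul_rpow_of_nonneg _ _ (by positivity),
            ENNReal.mul_rpow_of_nonneg _ _ (by positivity), ENNReal.mul_rpow_of_nonneg _ _ hpq0,
            ← ENNReal.rpow_mul, ← ENNReal.rpow_mul, ← ENNReal.rpow_mul,
            show -(κ / p) * (p / q) = -(κ / q) by field_simp,
            show p * (1 / q) = p / q by ring,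
            show (q - p) * (1 / q) = 1 - p / q by field_simp]
          ring
      _ ≤ 2 * lmNorm f p (ENNReal.ofReal r) κ ^ (p / q) * linftyNorm f ^ (1 - p / q) := by
          gcongr
          calc (2 : ℝ≥0∞) ^ (1 / q) ≤ 2 ^ (1 : ℝ) :=
                ENNReal.rpow_le_rpow_of_exponent_le (by norm_num)
                  ((div_le_one hq0).2 (by linarith))
            _ = 2 := ENNReal.rpow_one 2
  refine ⟨ne_top_of_le_ne_top ?_ main, main⟩
  exact ENNReal.mul_ne_top (ENNReal.mul_ne_top (by norm_num)
    (ENNReal.rpow_ne_top_of_nonneg hpq0 hLM)) (ENNReal.rpow_ne_top_of_nonneg hpq1 hLinf)
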